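/- (Optimality certification via Z(A).) Let A be an integer (r,s)×t bimatrix and let x be a feasible point of the n-fold integer program with objective w and finite bounds l, u. Then x is optimal if and only if there is no g = (g¹,…,gⁿ) ∈ ℤ^{nt} with every brick gⁱ in Z(A), A⁽ⁿ⁾g = 0, l ≤ x + g ≤ u, and w·g < 0. -/

import Mathlib

open Matrix

/-- The conformal (sign-compatible) partial order `x ⊑ y` on integer vectors:
`x k * y k ≥ 0` and `|x k| ≤ |y k|` for every coordinate `k`. -/
def ConformalLe {ν : Type*} (x y : ν → ℤ) : Prop :=
  ∀ k, 0 ≤ x k * y k ∧ |x k| ≤ |y k|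

/-- The Graver basis of an integer matrix `A`: the set of `⊑`-minimal elements of
`{x : A x = 0, x ≠ 0}`. -/
def GraverBasis {μ ν : Type*} [Fintype ν] (A : Matrix μ ν ℤ) : Set (ν → ℤ) :=
  {x | A.mulVec x = 0 ∧ x ≠ 0 ∧
    ∀ y, A.mulVec y = 0 → y ≠ 0 → ConformalLe y x → y = x}

/-- The `ι`-fold product of the bimatrix with blocks `A1` (first block, `r × τ`) and
`A2` (second block, `s × τ`): the first `r` rows are `(A1 A1 ⋯ A1)` and the remaining
rows form a block-diagonal matrix with a copy of `A2` for each index in `ι`. -/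
def nFold {r s : ℕ} {τ : Type*} (A1 : Matrix (Fin r) τ ℤ) (A2 : Matrix (Fin s) τ ℤ)
    (ι : Type*) [DecidableEq ι] : Matrix (Fin r ⊕ ι × Fin s) (ι × τ) ℤ :=
  Matrix.of fun i jt =>
    match i with
    | Sum.inl a => A1 a jt.2
    | Sum.inr (k, c) => if jt.1 = k then A2 c jt.2 else 0

/-- The `i`-th brick of a vector indexed by `ι × τ`. -/
def brick {ι τ : Type*} (x : ι × τ → ℤ) (i : ι) : τ → ℤ := fun j => x (i, j)

/-- The Graver complexity of the bimatrix `(A1, A2)`: the largest number of nonzero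
bricks appearing in any element of the Graver basis of any `n`-fold product. -/
noncomputable def graverComplexity {r s t : ℕ} (A1 : Matrix (Fin r) (Fin t) ℤ)
    (A2 : Matrix (Fin s) (Fin t) ℤ) : ℕ :=
  sSup {k : ℕ | ∃ (n : ℕ) (g : Fin n × Fin t → ℤ),
    g ∈ GraverBasis (nFold A1 A2 (Fin n)) ∧
    k = {i : Fin n | brick g i ≠ 0}.ncard}

/-- `Z(A)`: the set of all vectors in `ℤ^t` that are sums of at most `g(A)` elements
of the Graver basis of `A2`. -/
noncomputable def ZSet {r s t : ℕ} (A1 : Matrix (Fin r) (Fin t) ℤ)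
    (A2 : Matrix (Fin s) (Fin t) ℤ) : Set (Fin t → ℤ) :=
  {z | ∃ L : List (Fin t → ℤ), L.length ≤ graverComplexity A1 A2 ∧
    (∀ h ∈ L, h ∈ GraverBasis A2) ∧ z = L.sum}

/-! ### The conformal order -/

theorem conformal_coord_iff {a b : ℤ} :
    (0 ≤ a * b ∧ |a| ≤ |b|) ↔ (0 ≤ a ∧ a ≤ b) ∨ (b ≤ a ∧ a ≤ 0) := by
  constructor
  · rintro ⟨h, h'⟩
    rcases mul_nonneg_iff.mp h with ⟨ha, hb⟩ | ⟨ha, hb⟩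
    · rw [abs_of_nonneg ha, abs_of_nonneg hb] at h'
      exact .inl ⟨ha, h'⟩
    · rw [abs_of_nonpos ha, abs_of_nonpos hb] at h'
      exact .inr ⟨by omega, ha⟩
  · rintro (⟨ha, hb⟩ | ⟨hb, ha⟩)
    · exact ⟨mul_nonneg ha (ha.trans hb), abs_le_abs_of_nonneg ha hb⟩
    · exact ⟨mul_nonneg_of_nonpos_of_nonpos ha (hb.trans ha), abs_le_abs_of_nonpos ha hb⟩

theorem conformalLe_iff {ν : Type*} {x y : ν → ℤ} :
    ConformalLe x y ↔ ∀ k, (0 ≤ x k ∧ x k ≤ y k) ∨ (y k ≤ x k ∧ x k ≤ 0) :=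
  forall_congr' fun _ => conformal_coord_iff

theorem ConformalLe.refl {ν : Type*} (x : ν → ℤ) : ConformalLe x x :=
  conformalLe_iff.2 fun k => by omega

theorem ConformalLe.trans {ν : Type*} {x y z : ν → ℤ} (hxy : ConformalLe x y)
    (hyz : ConformalLe y z) : ConformalLe x z := by
  rw [conformalLe_iff] at *
  intro k
  have := hxy k
  have := hyz k
  omega

theorem ConformalLe.sub {ν : Type*} {x y : ν → ℤ} (h : ConformalLe x y) :
    ConformalLe (y - x) y := by
  rw [conformalLe_iff] at *
  intro k
  have := h k
  simp only [Pi.sub_apply]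
  omega

theorem ConformalLe.sum_natAbs_lt {ν : Type*} [Fintype ν] {x y : ν → ℤ}
    (h : ConformalLe x y) (hne : x ≠ y) : ∑ k, (x k).natAbs < ∑ k, (y k).natAbs := by
  rw [conformalLe_iff] at h
  obtain ⟨k, hk⟩ := Function.ne_iff.1 hne
  refine Finset.sum_lt_sum (fun k _ => ?_) ⟨k, Finset.mem_univ k, ?_⟩
  · have := h k
    omega
  · have := h k
    omega

/-- The positive and negative parts of an integer vector. -/
def signParts {ν : Type*} (x : ν → ℤ) : ν × Bool → ℕ :=
  fun k => if k.2 then (x k.1).toNat else (-x k.1).toNat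

theorem conformalLe_of_signParts_le {ν : Type*} {x y : ν → ℤ}
    (h : signParts x ≤ signParts y) : ConformalLe x y := by
  refine conformalLe_iff.2 fun k => ?_
  have h1 := h (k, true)
  have h2 := h (k, false)
  simp only [signParts, if_true, Bool.false_eq_true, if_false] at h1 h2
  omega

theorem signParts_injective {ν : Type*} : Function.Injective (signParts (ν := ν)) := by
  intro x y h
  funext k
  have h1 := congrFun h (k, true)
  have h2 := congrFun h (k, false)
  simp only [signParts, if_true, Bool.false_eq_true, if_false] at h1 h2
  omega

/-! ### Graver bases -/

theorem graverBasis_finite {μ ν : Type*} [Fintype ν] (A : Matrix μ ν ℤ) :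
    (GraverBasis A).Finite := by
  refine Set.Finite.of_finite_image (f := signParts) ?_ signParts_injective.injOn
  refine WellQuasiOrderedLE.finite_of_isAntichain ?_
  rintro _ ⟨x, hx, rfl⟩ _ ⟨y, hy, rfl⟩ hne hle
  exact hne (congrArg signParts (hy.2.2 x hx.1 hx.2.1 (conformalLe_of_signParts_le hle)))

/-- Every integer vector in the kernel is a conformal sum of Graver basis elements. -/
theorem exists_conformal_decomposition {μ ν : Type*} [Fintype ν] (A : Matrix μ ν ℤ)
    (x : ν → ℤ) (hx : A.mulVec x = 0) :
    ∃ L : List (ν → ℤ), (∀ h ∈ L, h ∈ GraverBasis A ∧ ConformalLe h x) ∧ L.sum = x := by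
  induction hN : ∑ k, (x k).natAbs using Nat.strong_induction_on generalizing x with
  | _ N ih =>
  by_cases h0 : x = 0
  · exact ⟨[], by simp, by simp [h0]⟩
  by_cases hG : x ∈ GraverBasis A
  · exact ⟨[x], by simp [hG, ConformalLe.refl], by simp⟩
  simp only [GraverBasis, Set.mem_ofPred_eq] at hG
  push Not at hG
  obtain ⟨y, hy, hy0, hyx, hne⟩ := hG hx h0
  have hsub : A.mulVec (x - y) = 0 := by rw [Matrix.mulVec_sub, hx, hy, sub_zero]
  obtain ⟨L₁, hL₁, hs₁⟩ := ih _ (hN ▸ hyx.sum_natAbs_lt hne) y hy rfl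
  obtain ⟨L₂, hL₂, hs₂⟩ := ih _ (hN ▸ hyx.sub.sum_natAbs_lt (by simpa using hy0))
    (x - y) hsub rfl
  refine ⟨L₁ ++ L₂, fun h hh => ?_, by rw [List.sum_append, hs₁, hs₂, add_sub_cancel]⟩
  rcases List.mem_append.1 hh with hh | hh
  · exact ⟨(hL₁ h hh).1, (hL₁ h hh).2.trans hyx⟩
  · exact ⟨(hL₂ h hh).1, (hL₂ h hh).2.trans hyx.sub⟩

/-! ### Kernels of n-fold products and refinement of bricks -/

theorem nFold_mulVec_eq_zero_iff {r s : ℕ} {τ ι : Type*} [Fintype τ] [Fintype ι]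
    [DecidableEq ι] (A1 : Matrix (Fin r) τ ℤ) (A2 : Matrix (Fin s) τ ℤ) (x : ι × τ → ℤ) :
    (nFold A1 A2 ι).mulVec x = 0 ↔
      ∑ i, A1.mulVec (brick x i) = 0 ∧ ∀ i, A2.mulVec (brick x i) = 0 := by
  have h1 : ∀ a, (nFold A1 A2 ι).mulVec x (Sum.inl a) = (∑ i, A1.mulVec (brick x i)) a := by
    intro a
    simp [Matrix.mulVec, dotProduct, nFold, brick, Fintype.sum_prod_type]
  have h2 : ∀ k c, (nFold A1 A2 ι).mulVec x (Sum.inr (k, c)) = A2.mulVec (brick x k) c := by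
    intro k c
    simp only [Matrix.mulVec, dotProduct, nFold, brick, Fintype.sum_prod_type, Matrix.of_apply]
    rw [Finset.sum_eq_single k (by intro i _ hi; simp [hi]) (by simp)]
    simp
  constructor
  · intro h
    exact ⟨funext fun a => by rw [← h1, h]; rfl,
      fun k => funext fun c => by rw [← h2, h]; rfl⟩
  · rintro ⟨ha, hb⟩
    funext q
    rcases q with a | ⟨k, c⟩
    · rw [h1, ha]; rfl
    · rw [h2, hb]; rfl

theorem nFold_mulVec_fiberSum_eq_zero {r s : ℕ} {τ ι κ : Type*} [Fintype τ] [Fintype ι]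
    [DecidableEq ι] [Fintype κ] [DecidableEq κ] (A1 : Matrix (Fin r) τ ℤ)
    (A2 : Matrix (Fin s) τ ℤ) (f : κ → ι) {y : κ × τ → ℤ} {Y : ι × τ → ℤ}
    (hY : ∀ i, brick Y i = ∑ k with f k = i, brick y k)
    (hy : (nFold A1 A2 κ).mulVec y = 0) : (nFold A1 A2 ι).mulVec Y = 0 := by
  rw [nFold_mulVec_eq_zero_iff] at hy ⊢
  simp only [hY, Matrix.mulVec_sum]
  refine ⟨?_, fun i => Finset.sum_eq_zero fun k _ => hy.2 k⟩
  rw [Finset.sum_fiberwise]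
  exact hy.1

/-- Splitting the bricks of a Graver basis element of an n-fold product conformally
yields a Graver basis element of a larger n-fold product. -/
theorem mem_graverBasis_nFold_of_refinement {r s : ℕ} {τ ι κ : Type*} [Fintype τ] [Fintype ι]
    [DecidableEq ι] [Fintype κ] [DecidableEq κ] (A1 : Matrix (Fin r) τ ℤ)
    (A2 : Matrix (Fin s) τ ℤ) (f : κ → ι) {g : ι × τ → ℤ} {v : κ × τ → ℤ}
    (hg : g ∈ GraverBasis (nFold A1 A2 ι)) (hker : ∀ k, A2.mulVec (brick v k) = 0)
    (hsum : ∀ i, brick g i = ∑ k with f k = i, brick v k)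
    (hconf : ∀ k, ConformalLe (brick v k) (brick g (f k))) :
    v ∈ GraverBasis (nFold A1 A2 κ) := by
  have hsum' : ∀ i j, g (i, j) = ∑ k with f k = i, v (k, j) := fun i j => by
    simpa [brick] using congrFun (hsum i) j
  refine ⟨?_, ?_, ?_⟩
  · have h := ((nFold_mulVec_eq_zero_iff A1 A2 g).1 hg.1).1
    simp only [hsum, Matrix.mulVec_sum] at h
    rw [Finset.sum_fiberwise] at h
    exact (nFold_mulVec_eq_zero_iff A1 A2 v).2 ⟨h, hker⟩
  · rintro rfl
    refine hg.2.1 (funext fun ⟨i, j⟩ => ?_)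
    simp [hsum']
  · intro y hy hy0 hyv
    set Y : ι × τ → ℤ := fun p => ∑ k with f k = p.1, y (k, p.2) with hYdef
    have hcy : ∀ k j, (0 ≤ y (k, j) ∧ y (k, j) ≤ v (k, j)) ∨
        (v (k, j) ≤ y (k, j) ∧ y (k, j) ≤ 0) := fun k j => conformalLe_iff.1 hyv (k, j)
    have hcv : ∀ k j, (0 ≤ v (k, j) ∧ v (k, j) ≤ g (f k, j)) ∨
        (g (f k, j) ≤ v (k, j) ∧ v (k, j) ≤ 0) := fun k j => conformalLe_iff.1 (hconf k) j
    have hpos : ∀ i j, 0 ≤ g (i, j) → ∀ k ∈ Finset.univ.filter (f · = i),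
        0 ≤ y (k, j) ∧ y (k, j) ≤ v (k, j) := by
      intro i j h k hk
      obtain rfl := (Finset.mem_filter.1 hk).2
      have := hcy k j
      have := hcv k j
      omega
    have hneg : ∀ i j, g (i, j) ≤ 0 → ∀ k ∈ Finset.univ.filter (f · = i),
        v (k, j) ≤ y (k, j) ∧ y (k, j) ≤ 0 := by
      intro i j h k hk
      obtain rfl := (Finset.mem_filter.1 hk).2
      have := hcy k j
      have := hcv k j
      omega
    have hYg : Y = g := by
      refine hg.2.2 Y ?_ ?_ (conformalLe_iff.2 ?_)
      · exact nFold_mulVec_fiberSum_eq_zero A1 A2 f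
          (fun i => funext fun j => by simp [brick, hYdef]) hy
      · intro hY
        refine hy0 (funext fun ⟨k, j⟩ => ?_)
        have h0 : ∑ k' with f k' = f k, y (k', j) = 0 := congrFun hY (f k, j)
        have hk : k ∈ Finset.univ.filter (f · = f k) := by simp
        rcases le_total 0 (g (f k, j)) with h | h
        · exact (Finset.sum_eq_zero_iff_of_nonneg fun k' hk' => (hpos _ j h k' hk').1).1 h0 k hk
        · exact (Finset.sum_eq_zero_iff_of_nonpos fun k' hk' => (hneg _ j h k' hk').2).1 h0 k hk
      · rintro ⟨i, j⟩
        rcases le_total 0 (g (i, j)) with h | h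
        · refine .inl ⟨Finset.sum_nonneg fun k hk => (hpos i j h k hk).1, ?_⟩
          rw [hsum']
          exact Finset.sum_le_sum fun k hk => (hpos i j h k hk).2
        · refine .inr ⟨?_, Finset.sum_nonpos fun k hk => (hneg i j h k hk).2⟩
          rw [hsum']
          exact Finset.sum_le_sum fun k hk => (hneg i j h k hk).1
    funext ⟨k, j⟩
    have h0 : ∑ k' with f k' = f k, y (k', j) = ∑ k' with f k' = f k, v (k', j) :=
      (congrFun hYg (f k, j)).trans (hsum' _ _)
    have hk : k ∈ Finset.univ.filter (f · = f k) := by simp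
    rcases le_total 0 (g (f k, j)) with h | h
    · exact (Finset.sum_eq_sum_iff_of_le fun k' hk' => (hpos _ j h k' hk').2).1 h0 k hk
    · exact ((Finset.sum_eq_sum_iff_of_le fun k' hk' => (hneg _ j h k' hk').1).1 h0.symm k hk).symm

/-- A Graver basis element of an n-fold product refines to one all of whose bricks lie in
the Graver basis of `A2`. -/
theorem exists_graver_refinement {r s t n : ℕ} (A1 : Matrix (Fin r) (Fin t) ℤ)
    (A2 : Matrix (Fin s) (Fin t) ℤ) {g : Fin n × Fin t → ℤ}
    (hg : g ∈ GraverBasis (nFold A1 A2 (Fin n))) :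
    ∃ (m : ℕ) (v : Fin m × Fin t → ℤ) (f : Fin m → Fin n),
      v ∈ GraverBasis (nFold A1 A2 (Fin m)) ∧ (∀ k, brick v k ∈ GraverBasis A2) ∧
      ∀ i, brick g i = ∑ k with f k = i, brick v k := by
  choose L hL hLsum using fun i => exists_conformal_decomposition A2 (brick g i)
    (((nFold_mulVec_eq_zero_iff A1 A2 g).1 hg.1).2 i)
  let e := Fintype.equivFin (Σ i, Fin (L i).length)
  let v : Fin (Fintype.card (Σ i, Fin (L i).length)) × Fin t → ℤ :=
    fun p => (L (e.symm p.1).1).get (e.symm p.1).2 p.2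
  have hv : ∀ k, brick v k = (L (e.symm k).1).get (e.symm k).2 := fun k => rfl
  have hmem : ∀ k, brick v k ∈ GraverBasis A2 ∧
      ConformalLe (brick v k) (brick g (e.symm k).1) := fun k =>
    hv k ▸ hL _ _ (List.get_mem _ _)
  have hsum : ∀ i, brick g i = ∑ k with (e.symm k).1 = i, brick v k := by
    intro i
    simp only [hv]
    rw [Finset.sum_filter, e.symm.sum_comp
      (fun q : Σ i, Fin (L i).length => if q.1 = i then (L q.1).get q.2 else 0),
      Fintype.sum_sigma, Finset.sum_eq_single i (by intro j _ hj; simp [hj]) (by simp)]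
    simp only [if_true]
    rw [← hLsum i, ← Fin.sum_univ_getElem]
    rfl
  exact ⟨_, v, fun k => (e.symm k).1, mem_graverBasis_nFold_of_refinement A1 A2 _ hg
    (fun k => (hmem k).1.1) hsum fun k => (hmem k).2, fun k => (hmem k).1, hsum⟩

/-! ### Finiteness of the Graver complexity -/

theorem exists_bound_of_bricks_mem_graverBasis {r s t : ℕ} (A1 : Matrix (Fin r) (Fin t) ℤ)
    (A2 : Matrix (Fin s) (Fin t) ℤ) :
    ∃ B : ℕ, ∀ (m : ℕ) (v : Fin m × Fin t → ℤ), v ∈ GraverBasis (nFold A1 A2 (Fin m)) →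
      (∀ k, brick v k ∈ GraverBasis A2) → m ≤ B := by
  classical
  have := (graverBasis_finite A2).fintype
  let P : (GraverBasis A2 → ℕ) → Prop := fun c =>
    c ≠ 0 ∧ ∑ h, c h • A1.mulVec h.1 = 0
  have hfin : {c | Minimal P c}.Finite :=
    WellQuasiOrderedLE.finite_of_isAntichain (setOfPred_minimal_antichain P)
  obtain ⟨B, hB⟩ := (hfin.image fun c => ∑ h, c h).bddAbove
  refine ⟨B, fun m v hv hbr => ?_⟩
  let β : Fin m → GraverBasis A2 := fun k => ⟨brick v k, hbr k⟩
  let c : GraverBasis A2 → ℕ := fun h => (Finset.univ.filter (β · = h)).card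
  have hcm : ∑ h, c h = m := by
    simpa using (Finset.card_eq_sum_card_fiberwise (f := β) (s := Finset.univ)
      (t := Finset.univ) (by simp)).symm
  suffices hmin : Minimal P c from hcm ▸ hB ⟨c, hmin, rfl⟩
  have hker := (nFold_mulVec_eq_zero_iff A1 A2 v).1 hv.1
  refine ⟨⟨fun h0 => ?_, ?_⟩, fun d hd hdc => ?_⟩
  · obtain rfl : m = 0 := by rw [← hcm, h0]; simp
    exact hv.2.1 (funext fun p => p.1.elim0)
  · rw [← hker.1, ← Finset.sum_fiberwise Finset.univ β]
    refine Finset.sum_congr rfl fun h _ => ?_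
    rw [Finset.sum_congr rfl (g := fun _ => A1.mulVec h.1), Finset.sum_const]
    intro k hk
    rw [← (Finset.mem_filter.1 hk).2]
  · choose T hT hTc using fun h => Finset.exists_subset_card_eq (hdc h)
    have hTβ : ∀ {h k}, k ∈ T h → β k = h := fun hk => (Finset.mem_filter.1 (hT _ hk)).2
    let y : Fin m × Fin t → ℤ := fun p => if p.1 ∈ T (β p.1) then v p else 0
    have hy : ∀ k, brick y k = if k ∈ T (β k) then brick v k else 0 := by
      intro k
      funext j
      by_cases hk : k ∈ T (β k) <;> simp [brick, y, hk]
    have hyv : y = v := by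
      refine hv.2.2 y ((nFold_mulVec_eq_zero_iff A1 A2 y).2 ⟨?_, fun k => ?_⟩) (fun h0 => ?_) ?_
      · rw [← hd.2, ← Finset.sum_fiberwise Finset.univ β]
        refine Finset.sum_congr rfl fun h _ => ?_
        rw [← hTc h, ← Finset.sum_const, ← Finset.sum_subset (hT h)]
        · refine Finset.sum_congr rfl fun k hk => ?_
          obtain rfl := hTβ hk
          rw [hy, if_pos hk]
        · intro k hk hkT
          obtain rfl := (Finset.mem_filter.1 hk).2
          rw [hy, if_neg hkT, Matrix.mulVec_zero]
      · rw [hy]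
        split_ifs
        · exact hker.2 k
        · exact Matrix.mulVec_zero _
      · refine hd.1 (funext fun h => ?_)
        rw [← hTc h, Pi.zero_apply, Finset.card_eq_zero, Finset.eq_empty_iff_forall_notMem]
        intro k hk
        obtain rfl := hTβ hk
        have hyk := hy k
        rw [if_pos hk, h0] at hyk
        exact (hbr k).2.1 hyk.symm
      · refine conformalLe_iff.2 fun p => ?_
        simp only [y]
        split_ifs <;> omega
    intro h
    rw [← hTc h]
    refine Finset.card_le_card fun k hk => ?_
    obtain rfl := (Finset.mem_filter.1 hk).2
    by_contra hkT
    have hyk := hy k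
    rw [if_neg hkT, hyv] at hyk
    exact (hbr k).2.1 hyk

theorem bddAbove_graverComplexity {r s t : ℕ} (A1 : Matrix (Fin r) (Fin t) ℤ)
    (A2 : Matrix (Fin s) (Fin t) ℤ) :
    BddAbove {k : ℕ | ∃ (n : ℕ) (g : Fin n × Fin t → ℤ),
      g ∈ GraverBasis (nFold A1 A2 (Fin n)) ∧
      k = {i : Fin n | brick g i ≠ 0}.ncard} := by
  obtain ⟨B, hB⟩ := exists_bound_of_bricks_mem_graverBasis A1 A2
  refine ⟨B, ?_⟩
  rintro _ ⟨n, g, hg, rfl⟩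
  obtain ⟨m, v, f, hv, hbr, hsum⟩ := exists_graver_refinement A1 A2 hg
  have hsub : {i : Fin n | brick g i ≠ 0} ⊆ f '' Set.univ := by
    intro i hi
    rw [Set.mem_ofPred_eq, hsum i] at hi
    obtain ⟨k, hk, -⟩ := Finset.exists_ne_zero_of_sum_ne_zero hi
    exact ⟨k, trivial, (Finset.mem_filter.1 hk).2⟩
  calc {i : Fin n | brick g i ≠ 0}.ncard ≤ (f '' Set.univ).ncard :=
        Set.ncard_le_ncard hsub (Set.toFinite _)
    _ ≤ (Set.univ : Set (Fin m)).ncard := Set.ncard_image_le (Set.toFinite _)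
    _ = m := by simp [Set.ncard_univ]
    _ ≤ B := hB m v hv hbr

theorem brick_mem_ZSet_of_mem_graverBasis {r s t n : ℕ} (A1 : Matrix (Fin r) (Fin t) ℤ)
    (A2 : Matrix (Fin s) (Fin t) ℤ) {g : Fin n × Fin t → ℤ}
    (hg : g ∈ GraverBasis (nFold A1 A2 (Fin n))) (i : Fin n) :
    brick g i ∈ ZSet A1 A2 := by
  obtain ⟨m, v, f, hv, hbr, hsum⟩ := exists_graver_refinement A1 A2 hg
  have hm : m ≤ graverComplexity A1 A2 := by
    refine le_csSup (bddAbove_graverComplexity A1 A2) ⟨m, v, hv, ?_⟩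
    have : {k : Fin m | brick v k ≠ 0} = Set.univ := Set.eq_univ_of_forall fun k => (hbr k).2.1
    rw [this, Set.ncard_univ, Nat.card_eq_fintype_card, Fintype.card_fin]
  refine ⟨(Finset.univ.filter (f · = i)).toList.map (brick v), ?_, ?_, ?_⟩
  · rw [List.length_map, Finset.length_toList]
    exact ((Finset.card_le_univ _).trans_eq (Fintype.card_fin m)).trans hm
  · intro h hh
    obtain ⟨k, -, rfl⟩ := List.mem_map.1 hh
    exact hbr k
  · rw [Finset.sum_map_toList, hsum]

/-- **optimality certification via `Z(A)`.** A feasible point `x` of the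
`n`-fold integer program is optimal if and only if there is no `g` with all bricks in
`Z(A)`, `A⁽ⁿ⁾g = 0`, `l ≤ x + g ≤ u`, and `w·g < 0`. -/
theorem optimality_certification_via_ZSet {r s t n : ℕ}
    (A1 : Matrix (Fin r) (Fin t) ℤ) (A2 : Matrix (Fin s) (Fin t) ℤ)
    (w l u : Fin n × Fin t → ℤ) (b : Fin r ⊕ Fin n × Fin s → ℤ)
    (x : Fin n × Fin t → ℤ)
    (hxb : (nFold A1 A2 (Fin n)).mulVec x = b) (hxl : l ≤ x) (hxu : x ≤ u) :
    (∀ y : Fin n × Fin t → ℤ, (nFold A1 A2 (Fin n)).mulVec y = b →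
        l ≤ y → y ≤ u → w ⬝ᵥ x ≤ w ⬝ᵥ y) ↔
      ¬∃ g : Fin n × Fin t → ℤ, (∀ i, brick g i ∈ ZSet A1 A2) ∧
        (nFold A1 A2 (Fin n)).mulVec g = 0 ∧
        l ≤ x + g ∧ x + g ≤ u ∧ w ⬝ᵥ g < 0 := by
  constructor
  · rintro hopt ⟨g, -, hg, hl, hu, hw⟩
    have h := hopt (x + g) (by rw [Matrix.mulVec_add, hxb, hg, add_zero]) hl hu
    rw [dotProduct_add] at h
    linarith
  · intro hno y hyb hyl hyu
    by_contra! hlt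
    obtain ⟨L, hL, hLsum⟩ := exists_conformal_decomposition (nFold A1 A2 (Fin n)) (y - x)
      (by rw [Matrix.mulVec_sub, hxb, hyb, sub_self])
    have hneg : ∃ g ∈ L, w ⬝ᵥ g < 0 := by
      by_contra! hall
      have hdot : ∀ M : List (Fin n × Fin t → ℤ), (∀ g ∈ M, 0 ≤ w ⬝ᵥ g) → 0 ≤ w ⬝ᵥ M.sum := by
        intro M hM
        induction M with
        | nil => simp
        | cons a M ih =>
          simp only [List.forall_mem_cons] at hM
          rw [List.sum_cons, dotProduct_add]
          exact add_nonneg hM.1 (ih hM.2)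
      have h := hdot L hall
      rw [hLsum, dotProduct_sub] at h
      linarith
    obtain ⟨g, hgL, hgw⟩ := hneg
    obtain ⟨hg, hgc⟩ := hL g hgL
    rw [conformalLe_iff] at hgc
    refine hno ⟨g, brick_mem_ZSet_of_mem_graverBasis A1 A2 hg, hg.1, fun p => ?_, fun p => ?_,
      hgw⟩ <;>
    · have := hgc p
      have := hxl p
      have := hxu p
      have := hyl p
      have := hyu p
      simp only [Pi.sub_apply, Pi.add_apply] at *
      omega
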